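/- Let g be a C² Riemannian metric (in coordinates) on an exterior region {|x| ≥ ρ₀} of ℝ³ with g = δ + O₂(r^{−1}). Then there exist R₀ ≥ ρ₀ and a constant C such that for all |x| ≥ R₀: | R_g(x) − Σ_{i,j}(∂_i∂_j g_ij − ∂_j∂_j g_ii)(x) − E_g(x) | ≤ C|x|^{−5}, where E_g = −Σ_{i,j,l}(g_{il} − δ_{il})(2∂_j∂_l g_ij − ∂_j∂_j g_il − ∂_i∂_l g_jj) + Σ_{i,j,l}( −(∂_j g_jl)(∂_i g_il) + (∂_j g_jl)(∂_l g_ii) + (3/4)(∂_l g_ij)² − (1/4)(∂_l g_jj)(∂_l g_ii) − (1/2)(∂_l g_ij)(∂_j g_il) ). -/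

import Mathlib

noncomputable section

/-- Points of `ℝ³`. -/
abbrev E3 := EuclideanSpace ℝ (Fin 3)

/-- Partial derivative of `f` in the `i`-th coordinate direction. -/
def pd (f : E3 → ℝ) (i : Fin 3) (x : E3) : ℝ :=
  fderiv ℝ f x (EuclideanSpace.single i 1)

/-- Christoffel symbols `Γ^k_{ij} = (1/2) Σ_l g^{kl} (∂_j g_{il} + ∂_i g_{jl} − ∂_l g_{ij})`. -/
def Gamma (g : E3 → Matrix (Fin 3) (Fin 3) ℝ) (k i j : Fin 3) (x : E3) : ℝ :=
  (1 / 2) * ∑ l, (g x)⁻¹ k l *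
    (pd (fun y => g y i l) j x + pd (fun y => g y j l) i x - pd (fun y => g y i j) l x)

/-- Scalar curvature
`R_g = Σ_{i,k} g^{ik} (Σ_j (∂_j Γ^j_{ik} − ∂_i Γ^j_{jk}) + Σ_{j,m} (Γ^m_{ik}Γ^j_{jm} − Γ^m_{jk}Γ^j_{im}))`. -/
def scalarCurvature (g : E3 → Matrix (Fin 3) (Fin 3) ℝ) (x : E3) : ℝ :=
  ∑ i, ∑ k, (g x)⁻¹ i k *
    ((∑ j, (pd (fun y => Gamma g j i k y) j x - pd (fun y => Gamma g j j k y) i x))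
      + ∑ j, ∑ m, (Gamma g m i k x * Gamma g j j m x - Gamma g m j k x * Gamma g j i m x))

/-- The Kronecker delta. -/
def kron (i j : Fin 3) : ℝ := if i = j then 1 else 0

/-- `f = O₂(r^{−s})` on the region `{‖x‖ ≥ ρ₀}`. -/
def IsO2 (f : E3 → ℝ) (s ρ₀ : ℝ) : Prop :=
  ∃ C : ℝ, ∀ x : E3, ρ₀ ≤ ‖x‖ →
    |f x| ≤ C * ‖x‖ ^ (-s) ∧ (∀ i, |pd f i x| ≤ C * ‖x‖ ^ (-s - 1)) ∧
      ∀ i k, |pd (pd f i) k x| ≤ C * ‖x‖ ^ (-s - 2)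

/-- The quadratic error term `E_g` in the expansion of the scalar curvature:
`E_g = −Σ_{i,j,l}(g_{il} − δ_{il})(2∂_j∂_l g_ij − ∂_j∂_j g_il − ∂_i∂_l g_jj)
 + Σ_{i,j,l}( −(∂_j g_jl)(∂_i g_il) + (∂_j g_jl)(∂_l g_ii) + (3/4)(∂_l g_ij)²
   − (1/4)(∂_l g_jj)(∂_l g_ii) − (1/2)(∂_l g_ij)(∂_j g_il) )`. -/
def Eg (g : E3 → Matrix (Fin 3) (Fin 3) ℝ) (x : E3) : ℝ :=
  -(∑ i, ∑ j, ∑ l, (g x i l - kron i l) *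
      (2 * pd (pd (fun y => g y i j) l) j x - pd (pd (fun y => g y i l) j) j x
        - pd (pd (fun y => g y j j) l) i x))
  + ∑ i, ∑ j, ∑ l,
      (-(pd (fun y => g y j l) j x * pd (fun y => g y i l) i x)
        + pd (fun y => g y j l) j x * pd (fun y => g y i i) l x
        + (3 / 4) * (pd (fun y => g y i j) l x) ^ 2
        - (1 / 4) * pd (fun y => g y j j) l x * pd (fun y => g y i i) l x
        - (1 / 2) * pd (fun y => g y i j) l x * pd (fun y => g y i l) j x)

open Asymptotics in
/-- `f = O(r^{-n})` at infinity. -/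
def DecaysAtRate (n : ℕ) (f : E3 → ℝ) : Prop :=
  f =O[Bornology.cobounded E3] fun x => ‖x‖⁻¹ ^ n

namespace DecaysAtRate

variable {m n : ℕ} {f f' : E3 → ℝ}

theorem add (hf : DecaysAtRate n f) (hf' : DecaysAtRate n f') :
    DecaysAtRate n fun x => f x + f' x :=
  Asymptotics.IsBigO.add hf hf'

theorem sub (hf : DecaysAtRate n f) (hf' : DecaysAtRate n f') :
    DecaysAtRate n fun x => f x - f' x :=
  Asymptotics.IsBigO.sub hf hf'

theorem neg (hf : DecaysAtRate n f) : DecaysAtRate n fun x => -f x :=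
  Asymptotics.IsBigO.neg_left hf

theorem const_mul (c : ℝ) (hf : DecaysAtRate n f) : DecaysAtRate n fun x => c * f x :=
  Asymptotics.IsBigO.const_mul_left hf c

theorem sum {ι : Type*} {s : Finset ι} {F : ι → E3 → ℝ} (hF : ∀ i, DecaysAtRate n (F i)) :
    DecaysAtRate n fun x => ∑ i ∈ s, F i x :=
  Asymptotics.IsBigO.fun_sum fun i _ => hF i

theorem mul (hf : DecaysAtRate m f) (hf' : DecaysAtRate n f') :
    DecaysAtRate (m + n) fun x => f x * f' x := by
  simpa only [DecaysAtRate, pow_add] using Asymptotics.IsBigO.mul hf hf'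

theorem mono (hmn : m ≤ n) (hf : DecaysAtRate n f) : DecaysAtRate m f := by
  refine Asymptotics.IsBigO.trans hf (Asymptotics.IsBigO.of_bound 1 ?_)
  filter_upwards [tendsto_norm_cobounded_atTop.eventually_ge_atTop 1] with x hx
  rw [one_mul, Real.norm_of_nonneg (by positivity), Real.norm_of_nonneg (by positivity)]
  exact pow_le_pow_of_le_one (by positivity) (inv_le_one_of_one_le₀ hx) hmn

theorem congr (hf : DecaysAtRate n f) (h : ∀ᶠ x in Bornology.cobounded E3, f' x = f x) :
    DecaysAtRate n f' :=
  Asymptotics.IsBigO.congr' hf (h.mono fun _ hx => hx.symm) Filter.EventuallyEq.rfl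

theorem of_bound {C ρ s : ℝ} (hs : s = -(n : ℝ)) (h : ∀ x : E3, ρ ≤ ‖x‖ → |f x| ≤ C * ‖x‖ ^ s) :
    DecaysAtRate n f := by
  refine Asymptotics.IsBigO.of_bound C ?_
  filter_upwards [tendsto_norm_cobounded_atTop.eventually_ge_atTop ρ] with x hx
  have := h x hx
  rw [hs, Real.rpow_neg (norm_nonneg x), Real.rpow_natCast, ← inv_pow] at this
  rwa [Real.norm_eq_abs, Real.norm_of_nonneg (by positivity)]

theorem exists_bound (hf : DecaysAtRate n f) (ρ : ℝ) :
    ∃ R C : ℝ, ρ ≤ R ∧ ∀ x : E3, R ≤ ‖x‖ → |f x| ≤ C * ‖x‖ ^ (-(n : ℝ)) := by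
  obtain ⟨C, hC⟩ := Asymptotics.IsBigO.bound hf
  rw [← comap_norm_atTop, Filter.eventually_comap] at hC
  obtain ⟨R, hR⟩ := Filter.eventually_atTop.1 hC
  refine ⟨max ρ R, C, le_max_left _ _, fun x hx => ?_⟩
  have := hR ‖x‖ ((le_max_right _ _).trans hx) x rfl
  rw [Real.norm_of_nonneg (show 0 ≤ ‖x‖⁻¹ ^ n by positivity)] at this
  rwa [Real.rpow_neg (norm_nonneg x), Real.rpow_natCast, ← inv_pow]

theorem tendsto_zero (hf : DecaysAtRate 1 f) :
    Filter.Tendsto f (Bornology.cobounded E3) (nhds 0) := by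
  refine Asymptotics.IsBigO.trans_tendsto hf ?_
  simpa only [pow_one] using! tendsto_norm_cobounded_atTop.inv_tendsto_atTop

end DecaysAtRate

theorem kron_eq_one (i j : Fin 3) : kron i j = (1 : Matrix (Fin 3) (Fin 3) ℝ) i j := by
  rw [Matrix.one_apply, kron]

theorem decaysAtRate_kron (i j : Fin 3) : DecaysAtRate 0 fun _ => kron i j := by
  simpa [DecaysAtRate] using
    Asymptotics.isBigO_const_const (kron i j) (one_ne_zero (α := ℝ)) (Bornology.cobounded E3)

theorem pd_sub_const (f : E3 → ℝ) (c : ℝ) : pd (fun x => f x - c) = pd f := by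
  funext i x
  simp [pd, fderiv_sub_const]

section PartialDerivatives

variable {f f' : E3 → ℝ} {x : E3}

theorem pd_add (hf : DifferentiableAt ℝ f x) (hf' : DifferentiableAt ℝ f' x) (i : Fin 3) :
    pd (fun y => f y + f' y) i x = pd f i x + pd f' i x := by
  simp [pd, fderiv_fun_add hf hf']

theorem pd_sub (hf : DifferentiableAt ℝ f x) (hf' : DifferentiableAt ℝ f' x) (i : Fin 3) :
    pd (fun y => f y - f' y) i x = pd f i x - pd f' i x := by
  simp [pd, fderiv_fun_sub hf hf']

theorem pd_mul (hf : DifferentiableAt ℝ f x) (hf' : DifferentiableAt ℝ f' x) (i : Fin 3) :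
    pd (fun y => f y * f' y) i x = pd f i x * f' x + f x * pd f' i x := by
  simp only [pd, fderiv_fun_mul hf hf', add_apply, smul_apply, smul_eq_mul]
  ring

theorem pd_const_mul (hf : DifferentiableAt ℝ f x) (c : ℝ) (i : Fin 3) :
    pd (fun y => c * f y) i x = c * pd f i x := by
  simp [pd, fderiv_const_mul hf]

theorem pd_sum {F : Fin 3 → E3 → ℝ} (hF : ∀ l, DifferentiableAt ℝ (F l) x) (i : Fin 3) :
    pd (fun y => ∑ l, F l y) i x = ∑ l, pd (F l) i x := by
  simp [pd, fderiv_fun_sum fun l _ => hF l]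

theorem pd_congr (h : f =ᶠ[nhds x] f') (i : Fin 3) : pd f i x = pd f' i x := by
  rw [pd, pd, h.fderiv_eq]

theorem differentiableAt_pd (hf : ContDiffAt ℝ 2 f x) (i : Fin 3) :
    DifferentiableAt ℝ (pd f i) x :=
  ((hf.fderiv_right (m := 1) (by norm_num)).differentiableAt one_ne_zero).clm_apply
    (differentiableAt_const _)

theorem pd_comm (hf : ContDiffAt ℝ 2 f x) (i j : Fin 3) :
    pd (pd f i) j x = pd (pd f j) i x := by
  have hd : DifferentiableAt ℝ (fderiv ℝ f) x :=
    (hf.fderiv_right (m := 1) (by norm_num)).differentiableAt one_ne_zero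
  have key : ∀ a b, pd (pd f a) b x =
      fderiv ℝ (fderiv ℝ f) x (EuclideanSpace.single b 1) (EuclideanSpace.single a 1) := by
    intro a b
    change fderiv ℝ (fun y => fderiv ℝ f y (EuclideanSpace.single a 1)) x _ = _
    rw [fderiv_clm_apply hd (differentiableAt_const _)]
    simp
  rw [key, key]
  exact (hf.isSymmSndFDerivAt (by simp)) _ _

end PartialDerivatives

section Inverse

variable {g : E3 → Matrix (Fin 3) (Fin 3) ℝ}

theorem differentiableAt_inv_apply {x : E3}
    (hg : ∀ i j, DifferentiableAt ℝ (fun y => g y i j) x) (hx : (g x).det ≠ 0) (i j : Fin 3) :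
    DifferentiableAt ℝ (fun y => (g y)⁻¹ i j) x := by
  simp only [Matrix.inv_def, Ring.inverse_eq_inv', Matrix.smul_apply, smul_eq_mul]
  refine DifferentiableAt.mul (DifferentiableAt.inv ?_ hx) ?_
  · simp only [Matrix.det_fin_three]
    fun_prop
  · simp only [Matrix.adjugate_fin_three]
    fin_cases i <;> fin_cases j <;> simp <;> fun_prop

theorem pd_inv_apply {x : E3} (hg : ∀ i j, DifferentiableAt ℝ (fun y => g y i j) x)
    (hx : ∀ᶠ y in nhds x, (g y).det ≠ 0) (a i j : Fin 3) :
    pd (fun y => (g y)⁻¹ i j) a x =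
      -∑ m, (∑ l, (g x)⁻¹ i l * pd (fun y => g y l m) a x) * (g x)⁻¹ m j := by
  have hA := differentiableAt_inv_apply hg hx.self_of_nhds
  set dA : Matrix (Fin 3) (Fin 3) ℝ := Matrix.of fun i j => pd (fun y => (g y)⁻¹ i j) a x
  set dg : Matrix (Fin 3) (Fin 3) ℝ := Matrix.of fun i j => pd (fun y => g y i j) a x
  have hprod : dA * g x + (g x)⁻¹ * dg = 0 := by
    ext p q
    have hc : pd (fun y => ∑ l, (g y)⁻¹ p l * g y l q) a x = 0 := by
      have : (fun y => ∑ l, (g y)⁻¹ p l * g y l q) =ᶠ[nhds x]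
          fun _ => (1 : Matrix (Fin 3) (Fin 3) ℝ) p q := by
        filter_upwards [hx] with y hy
        rw [← Matrix.nonsing_inv_mul (g y) hy.isUnit, Matrix.mul_apply]
      rw [pd_congr this]
      simp [pd]
    rw [pd_sum (F := fun l y => (g y)⁻¹ p l * g y l q) fun l => (hA p l).mul (hg l q)] at hc
    simp only [pd_mul (hA p _) (hg _ q), Finset.sum_add_distrib] at hc
    simpa only [dA, dg, Matrix.add_apply, Matrix.mul_apply, Matrix.of_apply, Matrix.zero_apply]
      using hc
  have hu : IsUnit (g x).det := hx.self_of_nhds.isUnit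
  have : dA = -((g x)⁻¹ * dg * (g x)⁻¹) := by
    rw [← Matrix.mul_nonsing_inv_cancel_right (g x) dA hu, eq_neg_of_add_eq_zero_left hprod,
      Matrix.neg_mul]
  simpa only [dA, dg, Matrix.neg_apply, Matrix.mul_apply, Matrix.of_apply] using
    congrFun₂ this i j

theorem decaysAtRate_inv (hh : ∀ i j, DecaysAtRate 1 fun x => g x i j - kron i j)
    (i j : Fin 3) : DecaysAtRate 0 fun x => (g x)⁻¹ i j := by
  have hg : Filter.Tendsto g (Bornology.cobounded E3) (nhds 1) := by
    refine tendsto_pi_nhds.2 fun i => tendsto_pi_nhds.2 fun j => ?_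
    have := (hh i j).tendsto_zero.add_const (kron i j)
    simpa [kron_eq_one] using this
  have hd : Filter.Tendsto (fun x => (g x).det) (Bornology.cobounded E3) (nhds 1) := by
    rw [← Matrix.det_one (n := Fin 3)]
    exact ((continuous_id.matrix_det (R := ℝ) (n := Fin 3)).tendsto 1).comp hg
  have ha : Filter.Tendsto (fun x => (g x).adjugate i j) (Bornology.cobounded E3)
      (nhds ((1 : Matrix (Fin 3) (Fin 3) ℝ).adjugate i j)) :=
    (((continuous_id.matrix_adjugate (R := ℝ) (n := Fin 3)).matrix_elem i j).tendsto 1).comp hg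
  have := ((hd.inv₀ one_ne_zero).mul ha).isBigO_one ℝ
  simpa [DecaysAtRate, Matrix.inv_def, Ring.inverse_eq_inv'] using this

theorem decaysAtRate_inv_sub_kron (hh : ∀ i j, DecaysAtRate 1 fun x => g x i j - kron i j)
    (hdet : ∀ᶠ x in Bornology.cobounded E3, (g x).det ≠ 0) (i j : Fin 3) :
    DecaysAtRate 1 fun x => (g x)⁻¹ i j - kron i j := by
  refine (DecaysAtRate.sum (s := Finset.univ) fun l =>
    ((decaysAtRate_inv hh i l).mul (hh l j))).neg.congr ?_
  filter_upwards [hdet] with x hx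
  have : (g x)⁻¹ - 1 = -((g x)⁻¹ * (g x - 1)) := by
    rw [Matrix.mul_sub, Matrix.nonsing_inv_mul _ hx.isUnit, Matrix.mul_one, neg_sub]
  simpa [Matrix.mul_apply, kron_eq_one] using congrFun₂ this i j

theorem decaysAtRate_inv_sub_linear (hh : ∀ i j, DecaysAtRate 1 fun x => g x i j - kron i j)
    (hdet : ∀ᶠ x in Bornology.cobounded E3, (g x).det ≠ 0) (i j : Fin 3) :
    DecaysAtRate 2 fun x => (g x)⁻¹ i j - (kron i j - (g x i j - kron i j)) := by
  refine (DecaysAtRate.sum (s := Finset.univ) fun l =>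
    ((decaysAtRate_inv_sub_kron hh hdet i l).mul (hh l j))).neg.congr ?_
  filter_upwards [hdet] with x hx
  have : (g x)⁻¹ - (1 - (g x - 1)) = -(((g x)⁻¹ - 1) * (g x - 1)) := by
    rw [Matrix.sub_mul, Matrix.mul_sub, Matrix.nonsing_inv_mul _ hx.isUnit, Matrix.mul_one,
      Matrix.one_mul]
    abel
  simpa [Matrix.mul_apply, kron_eq_one] using congrFun₂ this i j

end Inverse

/-- The linear and quadratic parts of the scalar curvature of `δ + h`, where `D i j a` and
`H i j a b` stand for `∂_a h_ij` and `∂_b ∂_a h_ij`. -/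
theorem quadratic_expansion (h : Fin 3 → Fin 3 → ℝ) (D : Fin 3 → Fin 3 → Fin 3 → ℝ)
    (H : Fin 3 → Fin 3 → Fin 3 → Fin 3 → ℝ)
    (hs : ∀ i j, h i j = h j i) (Ds : ∀ i j a, D i j a = D j i a)
    (Hs : ∀ i j a b, H i j a b = H j i a b) (Hc : ∀ i j a b, H i j a b = H i j b a)
    (T : Fin 3 → Fin 3 → Fin 3 → ℝ) (hT : ∀ l i j, T l i j = D i l j + D j l i - D i j l)
    (T' : Fin 3 → Fin 3 → Fin 3 → Fin 3 → ℝ)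
    (hT' : ∀ a l i j, T' a l i j = H i l j a + H j l i a - H i j l a) :
    ∑ i, ∑ k, (kron i k * ((∑ j, (1 / 2 * T' j j i k - 1 / 2 * T' i j j k)) +
      ((∑ j, (1 / 2 * ∑ l, (-(D j l j * T l i k) - h j l * T' j l i k)
          - 1 / 2 * ∑ l, (-(D j l i * T l j k) - h j l * T' i l j k)))
        + ∑ j, ∑ m, (1 / 2 * T m i k * (1 / 2 * T j j m) - 1 / 2 * T m j k * (1 / 2 * T j i m))))
      - h i k * ∑ j, (1 / 2 * T' j j i k - 1 / 2 * T' i j j k))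
    = (∑ i, ∑ j, (H i j i j - H i i j j))
      + (-(∑ i, ∑ j, ∑ l, h i l * (2 * H i j l j - H i l j j - H j j l i))
        + ∑ i, ∑ j, ∑ l, (-(D j l j * D i l i) + D j l j * D i i l + (3 / 4) * (D i j l) ^ 2
        - (1 / 4) * D j j l * D i i l - (1 / 2) * D i j l * D i l j)) := by
  have k0 : ∀ i j : Fin 3, kron i j = if i = j then 1 else 0 := fun _ _ => rfl
  simp only [hT, hT', k0, ite_mul, one_mul, zero_mul, Finset.sum_sub_distrib, Finset.sum_ite_eq,
    Finset.mem_univ, if_true]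
  simp only [Fin.sum_univ_three, hs 1 0, hs 2 0, hs 2 1, Ds 1 0, Ds 2 0, Ds 2 1,
    Hs 1 0, Hs 2 0, Hs 2 1, Hc _ _ 1 0, Hc _ _ 2 0, Hc _ _ 2 1]
  ring

/-- Twice the Christoffel symbols of the first kind. -/
def loweredChristoffel (g : E3 → Matrix (Fin 3) (Fin 3) ℝ) (l i j : Fin 3) (x : E3) : ℝ :=
  pd (fun y => g y i l) j x + pd (fun y => g y j l) i x - pd (fun y => g y i j) l x

/-- A `C²` metric on a neighbourhood of infinity with `g = δ + O₂(r^{-1})`. -/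
structure IsAsymptoticallyFlat (g : E3 → Matrix (Fin 3) (Fin 3) ℝ) : Prop where
  decay : ∀ i j, DecaysAtRate 1 fun x => g x i j - kron i j
  decay_pd : ∀ i j a, DecaysAtRate 2 (pd (fun y => g y i j) a)
  decay_pd_pd : ∀ i j a b, DecaysAtRate 3 (pd (pd (fun y => g y i j) a) b)
  contDiffAt : ∀ᶠ x in Bornology.cobounded E3, ∀ i j, ContDiffAt ℝ 2 (fun y => g y i j) x
  det_ne_zero : ∀ᶠ x in Bornology.cobounded E3, ∀ᶠ y in nhds x, (g y).det ≠ 0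
  symm : ∀ᶠ x in Bornology.cobounded E3, ∀ᶠ y in nhds x, (g y).IsSymm

theorem pd_loweredChristoffel {g : E3 → Matrix (Fin 3) (Fin 3) ℝ} {x : E3}
    (hg : ∀ i j, ContDiffAt ℝ 2 (fun y => g y i j) x) (a l i j : Fin 3) :
    DifferentiableAt ℝ (loweredChristoffel g l i j) x ∧
    pd (loweredChristoffel g l i j) a x = pd (pd (fun y => g y i l) j) a x
      + pd (pd (fun y => g y j l) i) a x - pd (pd (fun y => g y i j) l) a x := by
  have h1 := differentiableAt_pd (hg i l) j
  have h2 := differentiableAt_pd (hg j l) i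
  have h3 := differentiableAt_pd (hg i j) l
  refine ⟨(h1.add h2).sub h3, ?_⟩
  exact (pd_sub (h1.add h2) h3 a).trans (congrArg (· - _) (pd_add h1 h2 a))

theorem pd_Gamma {g : E3 → Matrix (Fin 3) (Fin 3) ℝ} {x : E3}
    (hg : ∀ i j, ContDiffAt ℝ 2 (fun y => g y i j) x) (hx : (g x).det ≠ 0) (a k i j : Fin 3) :
    pd (fun y => Gamma g k i j y) a x =
      1 / 2 * ∑ l, (pd (fun y => (g y)⁻¹ k l) a x * loweredChristoffel g l i j x
        + (g x)⁻¹ k l * pd (loweredChristoffel g l i j) a x) := by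
  have hA := differentiableAt_inv_apply (fun i j => (hg i j).differentiableAt two_ne_zero) hx k
  have hT := fun l => (pd_loweredChristoffel hg a l i j).1
  have hAT : ∀ l, DifferentiableAt ℝ (fun y => (g y)⁻¹ k l * loweredChristoffel g l i j y) x :=
    fun l => (hA l).mul (hT l)
  change pd (fun y => 1 / 2 * ∑ l, (g y)⁻¹ k l * loweredChristoffel g l i j y) a x = _
  rw [pd_const_mul (DifferentiableAt.fun_sum fun l _ => hAT l), pd_sum hAT]
  simp only [pd_mul (hA _) (hT _)]

namespace IsAsymptoticallyFlat

variable {g : E3 → Matrix (Fin 3) (Fin 3) ℝ}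

theorem det_ne_zero_self (hg : IsAsymptoticallyFlat g) :
    ∀ᶠ x in Bornology.cobounded E3, (g x).det ≠ 0 :=
  hg.det_ne_zero.mono fun _ hx => hx.self_of_nhds

theorem decay_pd_inv (hg : IsAsymptoticallyFlat g) (a i j : Fin 3) :
    DecaysAtRate 3 fun x => pd (fun y => (g y)⁻¹ i j) a x - -pd (fun y => g y i j) a x := by
  have hA := decaysAtRate_inv hg.decay
  have hA1 := decaysAtRate_inv_sub_kron hg.decay hg.det_ne_zero_self
  have h1 : DecaysAtRate 3 fun x => ∑ m, (∑ l, ((g x)⁻¹ i l - kron i l)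
      * pd (fun y => g y l m) a x) * (g x)⁻¹ m j :=
    .sum fun m => (DecaysAtRate.sum fun l => (hA1 i l).mul (hg.decay_pd l m a)).mul (hA m j)
  have h2 : DecaysAtRate 3 fun x => ∑ m, pd (fun y => g y i m) a x * ((g x)⁻¹ m j - kron m j) :=
    .sum fun m => (hg.decay_pd i m a).mul (hA1 m j)
  refine (h1.add h2).neg.congr ?_
  filter_upwards [hg.contDiffAt, hg.det_ne_zero] with x hx hx'
  rw [pd_inv_apply (fun i j => (hx i j).differentiableAt two_ne_zero) hx']
  simp only [sub_mul, mul_sub, Finset.sum_sub_distrib, kron, ite_mul, mul_ite, one_mul, mul_one,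
    zero_mul, mul_zero, Finset.sum_ite_eq, Finset.sum_ite_eq', Finset.mem_univ, if_true]
  ring

theorem decay_loweredChristoffel (hg : IsAsymptoticallyFlat g) (l i j : Fin 3) :
    DecaysAtRate 2 (loweredChristoffel g l i j) :=
  ((hg.decay_pd i l j).add (hg.decay_pd j l i)).sub (hg.decay_pd i j l)

theorem decay_pd_loweredChristoffel (hg : IsAsymptoticallyFlat g) (a l i j : Fin 3) :
    DecaysAtRate 3 (pd (loweredChristoffel g l i j) a) := by
  refine (((hg.decay_pd_pd i l j a).add (hg.decay_pd_pd j l i a)).sub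
    (hg.decay_pd_pd i j l a)).congr ?_
  filter_upwards [hg.contDiffAt] with x hx
  exact (pd_loweredChristoffel hx a l i j).2

theorem decay_Gamma_sub (hg : IsAsymptoticallyFlat g) (k i j : Fin 3) :
    DecaysAtRate 3 fun x => Gamma g k i j x - 1 / 2 * loweredChristoffel g k i j x := by
  refine (DecaysAtRate.const_mul (1 / 2) (DecaysAtRate.sum (s := Finset.univ) fun l =>
    (decaysAtRate_inv_sub_kron hg.decay hg.det_ne_zero_self k l).mul
      (hg.decay_loweredChristoffel l i j))).congr (.of_forall fun x => ?_)
  simp only [sub_mul, Finset.sum_sub_distrib, kron, ite_mul, one_mul, zero_mul,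
    Finset.sum_ite_eq, Finset.mem_univ, if_true, mul_sub]
  rfl

theorem decay_Gamma (hg : IsAsymptoticallyFlat g) (k i j : Fin 3) :
    DecaysAtRate 2 (Gamma g k i j) :=
  (((hg.decay_Gamma_sub k i j).mono (Nat.le_succ 2)).add
    ((hg.decay_loweredChristoffel k i j).const_mul (1 / 2))).congr
      (.of_forall fun _ => (sub_add_cancel _ _).symm)

theorem decay_Gamma_mul_Gamma_sub (hg : IsAsymptoticallyFlat g) (k i j k' i' j' : Fin 3) :
    DecaysAtRate 5 fun x => Gamma g k i j x * Gamma g k' i' j' x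
      - 1 / 2 * loweredChristoffel g k i j x * (1 / 2 * loweredChristoffel g k' i' j' x) := by
  refine (((hg.decay_Gamma_sub k i j).mul (hg.decay_Gamma k' i' j')).add
    (((hg.decay_loweredChristoffel k i j).const_mul (1 / 2)).mul
      (hg.decay_Gamma_sub k' i' j'))).congr (.of_forall fun x => ?_)
  ring

theorem decay_pd_Gamma_sub (hg : IsAsymptoticallyFlat g) (a k i j : Fin 3) :
    DecaysAtRate 5 fun x => pd (fun y => Gamma g k i j y) a x
      - (1 / 2 * pd (loweredChristoffel g k i j) a x
        + 1 / 2 * ∑ l, (-(pd (fun y => g y k l) a x * loweredChristoffel g l i j x)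
          - (g x k l - kron k l) * pd (loweredChristoffel g l i j) a x)) := by
  refine (DecaysAtRate.const_mul (1 / 2) (DecaysAtRate.sum (s := Finset.univ) fun l =>
    ((hg.decay_pd_inv a k l).mul (hg.decay_loweredChristoffel l i j)).add
    ((decaysAtRate_inv_sub_linear hg.decay hg.det_ne_zero_self k l).mul
      (hg.decay_pd_loweredChristoffel a l i j)))).congr ?_
  filter_upwards [hg.contDiffAt, hg.det_ne_zero_self] with x hx hx'
  have hk : pd (loweredChristoffel g k i j) a x =
      ∑ l, kron k l * pd (loweredChristoffel g l i j) a x := by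
    simp [kron]
  rw [pd_Gamma hx hx', hk, ← mul_add, ← mul_sub, ← Finset.sum_add_distrib,
    ← Finset.sum_sub_distrib]
  refine congrArg _ (Finset.sum_congr rfl fun l _ => ?_)
  ring

theorem decay_scalarCurvature_sub (hg : IsAsymptoticallyFlat g) :
    DecaysAtRate 5 fun x => scalarCurvature g x
      - (∑ i, ∑ j, (pd (pd (fun y => g y i j) i) j x - pd (pd (fun y => g y i i) j) j x))
      - Eg g x := by
  let T := loweredChristoffel g
  let X₁ (i k : Fin 3) (x : E3) : ℝ := ∑ j, (1 / 2 * pd (T j i k) j x - 1 / 2 * pd (T j j k) i x)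
  let Q (a k i j : Fin 3) (x : E3) : ℝ := 1 / 2 * ∑ l, (-(pd (fun y => g y k l) a x * T l i j x)
    - (g x k l - kron k l) * pd (T l i j) a x)
  let X₂ (i k : Fin 3) (x : E3) : ℝ := (∑ j, (Q j j i k x - Q i j j k x))
    + ∑ j, ∑ m, (1 / 2 * T m i k x * (1 / 2 * T j j m x) - 1 / 2 * T m j k x * (1 / 2 * T j i m x))
  let X (i k : Fin 3) (x : E3) : ℝ :=
    (∑ j, (pd (fun y => Gamma g j i k y) j x - pd (fun y => Gamma g j j k y) i x))
      + ∑ j, ∑ m, (Gamma g m i k x * Gamma g j j m x - Gamma g m j k x * Gamma g j i m x)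
  have hT := hg.decay_loweredChristoffel
  have hT' := hg.decay_pd_loweredChristoffel
  have hQ : ∀ a k i j, DecaysAtRate 4 (Q a k i j) := fun a k i j =>
    .const_mul _ (.sum fun l => ((hg.decay_pd k l a).mul (hT l i j)).neg.sub
      ((hg.decay k l).mul (hT' a l i j)))
  have hX₁ : ∀ i k, DecaysAtRate 3 (X₁ i k) := fun i k =>
    .sum fun j => ((hT' j j i k).const_mul _).sub ((hT' i j j k).const_mul _)
  have hX₂ : ∀ i k, DecaysAtRate 4 (X₂ i k) := fun i k =>
    (DecaysAtRate.sum fun j => (hQ j j i k).sub (hQ i j j k)).add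
      (.sum fun j => .sum fun m =>
        (((hT m i k).const_mul _).mul ((hT j j m).const_mul _)).sub
          (((hT m j k).const_mul _).mul ((hT j i m).const_mul _)))
  have hX : ∀ i k, DecaysAtRate 5 fun x => X i k x - (X₁ i k x + X₂ i k x) := by
    intro i k
    refine ((DecaysAtRate.sum (s := Finset.univ) fun j =>
      (hg.decay_pd_Gamma_sub j j i k).sub (hg.decay_pd_Gamma_sub i j j k)).add
      (DecaysAtRate.sum (s := Finset.univ) fun j => DecaysAtRate.sum (s := Finset.univ) fun m =>
        (hg.decay_Gamma_mul_Gamma_sub m i k j j m).sub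
          (hg.decay_Gamma_mul_Gamma_sub m j k j i m))).congr (.of_forall fun x => ?_)
    simp only [X, X₁, X₂, Q, T, Finset.sum_sub_distrib, Finset.sum_add_distrib]
    ring
  refine (DecaysAtRate.sum (s := Finset.univ) fun i => DecaysAtRate.sum (s := Finset.univ) fun k =>
    (((decaysAtRate_inv hg.decay i k).mul (hX i k)).add
      ((decaysAtRate_inv_sub_kron hg.decay hg.det_ne_zero_self i k).mul (hX₂ i k))).add
      ((decaysAtRate_inv_sub_linear hg.decay hg.det_ne_zero_self i k).mul (hX₁ i k))).congr ?_
  filter_upwards [hg.contDiffAt, hg.symm] with x hx hs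
  have hsymm : ∀ i j, (fun y => g y i j) =ᶠ[nhds x] fun y => g y j i := fun i j =>
    hs.mono fun y hy => hy.apply j i
  have hsymm' : ∀ i j a, pd (fun y => g y i j) a =ᶠ[nhds x] pd (fun y => g y j i) a :=
    fun i j a => (hsymm i j).eventuallyEq_nhds.mono fun y hy => pd_congr hy a
  have key := quadratic_expansion (fun i j => g x i j - kron i j)
    (fun i j a => pd (fun y => g y i j) a x) (fun i j a b => pd (pd (fun y => g y i j) a) b x)
    (fun i j => by simp only [(hsymm i j).self_of_nhds, kron, eq_comm])
    (fun i j a => (hsymm' i j a).self_of_nhds) (fun i j a b => pd_congr (hsymm' i j a) b)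
    (fun i j a b => pd_comm (hx i j) a b) (fun l i j => T l i j x) (fun _ _ _ => rfl)
    (fun a l i j => pd (T l i j) a x) (fun a l i j => (pd_loweredChristoffel hx a l i j).2)
  rw [sub_sub]
  refine (congrArg (scalarCurvature g x - ·) key.symm).trans ?_
  simp only [scalarCurvature, ← Finset.sum_sub_distrib]
  refine Finset.sum_congr rfl fun i _ => Finset.sum_congr rfl fun k _ => ?_
  change (g x)⁻¹ i k * X i k x
    - (kron i k * (X₁ i k x + X₂ i k x) - (g x i k - kron i k) * X₁ i k x) = _
  ring

end IsAsymptoticallyFlat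

/-- Lemma 3.8 of the paper: for a C² asymptotically flat metric
`g = δ + O₂(r^{−1})` on an exterior region, the scalar curvature has the expansion
`R_g = Σ_{i,j}(∂_i∂_j g_ij − ∂_j∂_j g_ii) + E_g + O(r^{−5})`. -/
theorem scalar_curvature_expansion
    (ρ₀ : ℝ) (hρ₀ : 0 < ρ₀)
    (g : E3 → Matrix (Fin 3) (Fin 3) ℝ)
    (hgreg : ∀ i j, ContDiffOn ℝ 2 (fun x => g x i j) {x : E3 | ρ₀ ≤ ‖x‖})
    (hgpos : ∀ x : E3, ρ₀ ≤ ‖x‖ → (g x).PosDef)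
    (hgsymm : ∀ x : E3, ρ₀ ≤ ‖x‖ → (g x).IsSymm)
    (hgdecay : ∀ i j, IsO2 (fun x => g x i j - kron i j) 1 ρ₀) :
    ∃ R₀ C : ℝ, ρ₀ ≤ R₀ ∧ ∀ x : E3, R₀ ≤ ‖x‖ →
      |scalarCurvature g x
        - (∑ i, ∑ j, (pd (pd (fun y => g y i j) i) j x - pd (pd (fun y => g y i i) j) j x))
        - Eg g x| ≤ C * ‖x‖ ^ (-5 : ℝ) := by
  have hreg : ∀ x : E3, ρ₀ < ‖x‖ → ∀ᶠ y in nhds x, ρ₀ ≤ ‖y‖ := fun x hx =>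
    (continuous_norm.continuousAt.eventually (lt_mem_nhds hx)).mono fun _ hy => le_of_lt hy
  have hlarge : ∀ᶠ x in Bornology.cobounded E3, ρ₀ < ‖x‖ :=
    tendsto_norm_cobounded_atTop.eventually_gt_atTop ρ₀
  have hflat : IsAsymptoticallyFlat g := by
    refine ⟨fun i j => ?_, fun i j a => ?_, fun i j a b => ?_, ?_, ?_, ?_⟩
    · obtain ⟨C, hC⟩ := hgdecay i j
      exact .of_bound (by norm_num) fun x hx => (hC x hx).1
    · obtain ⟨C, hC⟩ := hgdecay i j
      rw [pd_sub_const] at hC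
      exact .of_bound (by norm_num) fun x hx => (hC x hx).2.1 a
    · obtain ⟨C, hC⟩ := hgdecay i j
      rw [pd_sub_const] at hC
      exact .of_bound (by norm_num) fun x hx => (hC x hx).2.2 a b
    · exact hlarge.mono fun x hx i j => (hgreg i j).contDiffAt (hreg x hx)
    · exact hlarge.mono fun x hx => (hreg x hx).mono fun y hy => (hgpos y hy).det_pos.ne'
    · exact hlarge.mono fun x hx => (hreg x hx).mono hgsymm
  simpa using hflat.decay_scalarCurvature_sub.exists_bound ρ₀
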